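/- arXiv:gr-qc/0606011 — 4 statements merged into one kernel-verified Lean document; each statement's English description precedes it below -/
import Mathlib

section
/- Suppose N ≥ 1 and η₀ = 0. Then the Hubble parameter H(t) = ȧ(t)/a(t) has the following one-sided limit as t → t⊙ from the right: if η₁ > 1 then H(t) → 0; if η₁ = 1 then H(t) → c₁/c₀; if 0 < η₁ < 1 then H(t) → +∞ when c₁ > 0 and H(t) → −∞ when c₁ < 0. In particular H has a finite limit at a sudden singularity or extremality event precisely when η₁ ≥ 1. -/
open Filter Topology

/-- A positive real power of `t - t0` vanishes as `t` decreases to `t0`. -/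
theorem tendsto_sub_rpow_nhdsGT_of_pos (t0 : ℝ) {p : ℝ} (hp : 0 < p) :
    Tendsto (fun t => (t - t0) ^ p) (𝓝[>] t0) (𝓝 0) := by
  have hcont : Continuous (fun t : ℝ => (t - t0) ^ p) :=
    (continuous_id.sub continuous_const).rpow_const fun _ => Or.inr hp.le
  have h := hcont.tendsto t0
  simp only [sub_self, Real.zero_rpow hp.ne'] at h
  exact h.mono_left nhdsWithin_le_nhds

/-- A finite sum of real powers of `t - t0` in which only the exponent `e k = 0` is nonpositive
among the terms with nonzero coefficient tends to the coefficient `b k`. -/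
theorem tendsto_sum_mul_sub_rpow_nhdsGT (t0 : ℝ) (s : Finset ℕ) (b e : ℕ → ℝ) (k : ℕ)
    (hk : k ∈ s) (hek : e k = 0) (he : ∀ i ∈ s, i ≠ k → b i = 0 ∨ 0 < e i) :
    Tendsto (fun t => ∑ i ∈ s, b i * (t - t0) ^ e i) (𝓝[>] t0) (𝓝 (b k)) := by
  have hterm : ∀ i ∈ s, Tendsto (fun t => b i * (t - t0) ^ e i) (𝓝[>] t0)
      (𝓝 (if i = k then b k else 0)) := by
    intro i hi
    by_cases hik : i = k
    · subst hik
      simp [hek]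
    · rw [if_neg hik]
      rcases he i hi hik with hb | hpos
      · simp [hb]
      · simpa using (tendsto_sub_rpow_nhdsGT_of_pos t0 hpos).const_mul (b i)
  simpa [Finset.sum_ite_eq', hk] using tendsto_finsetSum s hterm

/-- Termwise differentiation of a finite sum of real powers of `t - t0`. -/
theorem hasDerivAt_sum_mul_sub_rpow (t0 : ℝ) (s : Finset ℕ) (c η : ℕ → ℝ) {t : ℝ} (ht : t0 < t) :
    HasDerivAt (fun t => ∑ i ∈ s, c i * (t - t0) ^ η i)
      (∑ i ∈ s, c i * (η i * (t - t0) ^ (η i - 1))) t := by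
  refine HasDerivAt.fun_sum fun i _ => ?_
  have h := ((hasDerivAt_id t).sub_const t0).rpow_const (p := η i)
    (Or.inl (sub_pos.2 ht).ne')
  simpa using h.const_mul (c i)

/-- The map `t ↦ t - t0` sends right neighbourhoods of `t0` to right neighbourhoods of `0`. -/
theorem tendsto_sub_const_nhdsGT_zero (t0 : ℝ) :
    Tendsto (fun t => t - t0) (𝓝[>] t0) (𝓝[>] 0) := by
  refine tendsto_nhdsWithin_iff.2 ⟨?_, ?_⟩
  · have h : Tendsto (fun t => t - t0) (𝓝 t0) (𝓝 (t0 - t0)) :=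
      (continuous_id.sub continuous_const).tendsto t0
    rw [sub_self] at h
    exact h.mono_left nhdsWithin_le_nhds
  · filter_upwards [self_mem_nhdsWithin] with t ht using sub_pos.2 (Set.mem_Ioi.1 ht)

/-- For a generalized power-series scale factor with `η₀ = 0` (sudden singularities
and extremality events), the one-sided limit of the Hubble parameter `H = ȧ/a`
at the milestone is: `0` if `η₁ > 1`; `c₁/c₀` if `η₁ = 1`; `±∞` (according to the
sign of `c₁`) if `0 < η₁ < 1`.  In particular `H` has a finite limit iff `η₁ ≥ 1`. -/
theorem hubble_limit_for_sudden_singularities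
    (t0 δ : ℝ) (N : ℕ) (η c : ℕ → ℝ) (a : ℝ → ℝ)
    (hN : 1 ≤ N)
    (hδ : 0 < δ)
    (hηmono : ∀ i j : ℕ, i < j → j ≤ N → η i < η j)
    (hc0 : 0 < c 0)
    (hcne : ∀ i : ℕ, i ≤ N → c i ≠ 0)
    (ha : ∀ t ∈ Set.Ioo t0 (t0 + δ),
      a t = ∑ i ∈ Finset.range (N + 1), c i * (t - t0) ^ (η i))
    (hη0 : η 0 = 0) :
    (1 < η 1 →
      Tendsto (fun t => deriv a t / a t) (𝓝[>] t0) (𝓝 0)) ∧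
    (η 1 = 1 →
      Tendsto (fun t => deriv a t / a t) (𝓝[>] t0) (𝓝 (c 1 / c 0))) ∧
    (0 < η 1 ∧ η 1 < 1 →
      (0 < c 1 → Tendsto (fun t => deriv a t / a t) (𝓝[>] t0) atTop) ∧
      (c 1 < 0 → Tendsto (fun t => deriv a t / a t) (𝓝[>] t0) atBot)) ∧
    ((∃ L : ℝ, Tendsto (fun t => deriv a t / a t) (𝓝[>] t0) (𝓝 L)) ↔ 1 ≤ η 1) := by
  have hη1 : 0 < η 1 := hη0 ▸ hηmono 0 1 one_pos hN
  have hlt : ∀ k i, k < i → i ∈ Finset.range (N + 1) → η k < η i := fun k i hki hi =>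
    hηmono k i hki (Nat.lt_succ_iff.1 (Finset.mem_range.1 hi))
  have hA : Tendsto a (𝓝[>] t0) (𝓝 (c 0)) := by
    refine (tendsto_sum_mul_sub_rpow_nhdsGT t0 (Finset.range (N + 1)) c η 0 (by simp) hη0
      fun i hi h0 => Or.inr (hη0 ▸ hlt 0 i (Nat.pos_of_ne_zero h0) hi)).congr' ?_
    filter_upwards [Ioo_mem_nhdsGT (show t0 < t0 + δ by linarith)] with t ht using (ha t ht).symm
  have hG := tendsto_sum_mul_sub_rpow_nhdsGT t0 (Finset.range (N + 1)) (fun i => c i * η i)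
    (fun i => η i - η 1) 1 (Finset.mem_range.2 (by omega)) (sub_self _) (by
      intro i hi h1
      rcases Nat.eq_zero_or_pos i with rfl | hpos
      · simp [hη0]
      · exact Or.inr (sub_pos.2 (hlt 1 i (by omega) hi)))
  set Q : ℝ → ℝ := fun t =>
    (∑ i ∈ Finset.range (N + 1), c i * η i * (t - t0) ^ (η i - η 1)) / a t with hQdef
  have hQ : Tendsto Q (𝓝[>] t0) (𝓝 (c 1 * η 1 / c 0)) := hG.div hA hc0.ne'
  have hH : (fun t => (t - t0) ^ (η 1 - 1) * Q t) =ᶠ[𝓝[>] t0] fun t => deriv a t / a t := by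
    filter_upwards [Ioo_mem_nhdsGT (show t0 < t0 + δ by linarith)] with t ht
    have hloc : a =ᶠ[𝓝 t] fun t => ∑ i ∈ Finset.range (N + 1), c i * (t - t0) ^ η i := by
      filter_upwards [Ioo_mem_nhds ht.1 ht.2] with u hu using ha u hu
    rw [hloc.deriv_eq, (hasDerivAt_sum_mul_sub_rpow t0 _ c η ht.1).deriv, hQdef]
    simp only
    rw [← mul_div_assoc, Finset.mul_sum]
    congr 1
    refine Finset.sum_congr rfl fun i _ => ?_
    rw [show η i - 1 = (η 1 - 1) + (η i - η 1) by ring, Real.rpow_add (sub_pos.2 ht.1)]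
    ring
  have hgt : 1 < η 1 → Tendsto (fun t => deriv a t / a t) (𝓝[>] t0) (𝓝 0) := by
    intro h
    simpa using ((tendsto_sub_rpow_nhdsGT_of_pos t0 (sub_pos.2 h)).mul hQ).congr' hH
  have heq : η 1 = 1 → Tendsto (fun t => deriv a t / a t) (𝓝[>] t0) (𝓝 (c 1 / c 0)) := by
    intro h
    simpa only [h, mul_one] using hQ.congr' (by
      simpa only [h, sub_self, Real.rpow_zero, one_mul] using hH)
  have hpow : η 1 < 1 → Tendsto (fun t => (t - t0) ^ (η 1 - 1)) (𝓝[>] t0) atTop := fun h =>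
    (tendsto_rpow_neg_nhdsGT_zero (sub_neg.2 h)).comp (tendsto_sub_const_nhdsGT_zero t0)
  have htop : η 1 < 1 → 0 < c 1 →
      Tendsto (fun t => deriv a t / a t) (𝓝[>] t0) atTop := fun h hc =>
    ((hpow h).atTop_mul_pos (div_pos (mul_pos hc hη1) hc0) hQ).congr' hH
  have hbot : η 1 < 1 → c 1 < 0 →
      Tendsto (fun t => deriv a t / a t) (𝓝[>] t0) atBot := fun h hc =>
    ((hpow h).atTop_mul_neg (div_neg_of_neg_of_pos (mul_neg_of_neg_of_pos hc hη1) hc0)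
      hQ).congr' hH
  refine ⟨hgt, heq, fun h => ⟨htop h.2, hbot h.2⟩, ?_, ?_⟩
  · rintro ⟨L, hL⟩
    by_contra! h
    rcases (hcne 1 hN).lt_or_gt with hc | hc
    · exact not_tendsto_nhds_of_tendsto_atBot (hbot h hc) L hL
    · exact not_tendsto_nhds_of_tendsto_atTop (htop h hc) L hL
  · intro h
    rcases h.eq_or_lt with h | h
    · exact ⟨_, heq h.symm⟩
    · exact ⟨_, hgt h⟩
end

section
/- Suppose N ≥ 2 and k ∈ {−1, 0, 1}. The orthonormal Einstein component G_t̂t̂(t) = 3(ȧ(t)²/a(t)² + k/a(t)²) converges to a finite real limit as t → t⊙ from the right if and only if either (i) η₀ = 0 and η₁ ≥ 1, or (ii) η₀ = 1, k = −1, c₀ = 1 and η₁ ≥ 3. In all other cases G_t̂t̂(t) diverges to +∞ or −∞ as t → t⊙ from the right. -/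
open Filter Topology

lemma tendsto_rpow_nhdsGT_zero_of_pos {p : ℝ} (hp : 0 < p) :
    Tendsto (fun s : ℝ => s ^ p) (𝓝[>] 0) (𝓝 0) := by
  have := (Real.continuousAt_rpow_const 0 p (Or.inr hp.le)).tendsto
  rw [Real.zero_rpow hp.ne'] at this
  exact this.mono_left nhdsWithin_le_nhds

lemma exists_tendsto_rpow_nhdsGT_zero {p : ℝ} (hp : 0 ≤ p) :
    ∃ L : ℝ, Tendsto (fun s : ℝ => s ^ p) (𝓝[>] 0) (𝓝 L) :=
  ⟨_, (Real.continuousAt_rpow_const 0 p (Or.inr hp)).tendsto.mono_left nhdsWithin_le_nhds⟩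

/-- A finite generalized power series is its leading monomial times a factor which tends to the
leading coefficient. -/
lemma exists_rpow_mul_eq_sum (n : ℕ) (e d : ℕ → ℝ) (he : ∀ i, 0 < i → i ≤ n → e 0 < e i) :
    ∃ D : ℝ → ℝ, Tendsto D (𝓝[>] 0) (𝓝 (d 0)) ∧
      ∀ s : ℝ, 0 < s → ∑ i ∈ Finset.range (n + 1), d i * s ^ e i = s ^ e 0 * D s := by
  refine ⟨fun s => ∑ i ∈ Finset.range (n + 1), d i * s ^ (e i - e 0), ?_, fun s hs => ?_⟩
  · have hsum : ∑ i ∈ Finset.range (n + 1), d i * (if i = 0 then (1 : ℝ) else 0) = d 0 := by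
      simp
    rw [← hsum]
    refine tendsto_finsetSum _ fun i hi => Tendsto.const_mul _ ?_
    rcases Nat.eq_zero_or_pos i with rfl | hi0
    · simp
    · rw [if_neg hi0.ne']
      exact tendsto_rpow_nhdsGT_zero_of_pos
        (sub_pos.2 (he i hi0 (Nat.lt_succ_iff.1 (Finset.mem_range.1 hi))))
  · rw [Finset.mul_sum]
    refine Finset.sum_congr rfl fun i _ => ?_
    rw [mul_left_comm, ← Real.rpow_add hs]
    congr 2
    ring

/-- The component `G_t̂t̂` as a function of `s = t - t⊙`, where `a = s ^ p * A` and
`ȧ = s ^ (p - 1) * B`. -/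
noncomputable def gttLeading (k p : ℝ) (A B : ℝ → ℝ) (s : ℝ) : ℝ :=
  3 * ((s ^ (p - 1) * B s) ^ 2 / (s ^ p * A s) ^ 2 + k / (s ^ p * A s) ^ 2)

section Leading

variable {k p q x y : ℝ} {A B C : ℝ → ℝ}

lemma eventually_gttLeading_eq_add (k p : ℝ) (A B : ℝ → ℝ) :
    ∀ᶠ s in 𝓝[>] (0 : ℝ), gttLeading k p A B s =
      3 * ((s ^ (-1 : ℝ)) ^ 2 * (B s / A s) ^ 2 + k * (s ^ (-p) / A s) ^ 2) := by
  filter_upwards [self_mem_nhdsWithin] with s (hs : 0 < s)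
  have hp : s ^ p ≠ 0 := (Real.rpow_pos_of_pos hs p).ne'
  have h1 : s ^ (p - 1) = s ^ p * s ^ (-1 : ℝ) := by rw [← Real.rpow_add hs, sub_eq_add_neg]
  rw [gttLeading, h1, Real.rpow_neg hs.le p]
  rcases eq_or_ne (A s) 0 with hA | hA
  · simp [hA]
  · field_simp

lemma gttLeading_eq_mul (k p : ℝ) (A B : ℝ → ℝ) :
    gttLeading k p A B = fun s =>
      3 * (((s ^ (p - 1) * B s) ^ 2 + k) * ((s ^ p * A s) ^ 2)⁻¹) := by
  funext s
  rw [gttLeading]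
  ring

lemma tendsto_inv_sq_rpow_mul (hp : 0 < p) (hx : 0 < x) (hA : Tendsto A (𝓝[>] 0) (𝓝 x)) :
    Tendsto (fun s : ℝ => ((s ^ p * A s) ^ 2)⁻¹) (𝓝[>] 0) atTop := by
  refine Tendsto.inv_tendsto_nhdsGT_zero (tendsto_nhdsWithin_iff.2 ⟨?_, ?_⟩)
  · simpa using ((tendsto_rpow_nhdsGT_zero_of_pos hp).mul hA).pow 2
  · filter_upwards [self_mem_nhdsWithin, hA.eventually_const_lt hx] with s (hs : 0 < s) hAs
    exact pow_pos (mul_pos (Real.rpow_pos_of_pos hs p) hAs) 2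

lemma tendsto_gttLeading_of_neg (hp : p < 0) (hx : 0 < x) (hy : y ≠ 0)
    (hA : Tendsto A (𝓝[>] 0) (𝓝 x)) (hB : Tendsto B (𝓝[>] 0) (𝓝 y)) :
    Tendsto (gttLeading k p A B) (𝓝[>] 0) atTop := by
  rw [tendsto_congr' (eventually_gttLeading_eq_add k p A B)]
  refine Tendsto.const_mul_atTop (by norm_num) (Tendsto.atTop_add (Tendsto.atTop_mul_pos
    (C := (y / x) ^ 2) (by positivity) ?_ ((hB.div hA hx.ne').pow 2))
    ((((tendsto_rpow_nhdsGT_zero_of_pos (neg_pos.2 hp)).div hA hx.ne').pow 2).const_mul k))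
  exact (tendsto_pow_atTop two_ne_zero).comp (tendsto_rpow_neg_nhdsGT_zero (by norm_num))

lemma tendsto_gttLeading_of_flat (hx : 0 < x) (hy : y ≠ 0)
    (hA : Tendsto A (𝓝[>] 0) (𝓝 x)) (hB : Tendsto B (𝓝[>] 0) (𝓝 y)) :
    Tendsto (gttLeading 0 p A B) (𝓝[>] 0) atTop := by
  rw [tendsto_congr' (eventually_gttLeading_eq_add 0 p A B)]
  simp only [zero_mul, add_zero]
  refine Tendsto.const_mul_atTop (by norm_num) (Tendsto.atTop_mul_pos
    (C := (y / x) ^ 2) (by positivity) ?_ ((hB.div hA hx.ne').pow 2))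
  exact (tendsto_pow_atTop two_ne_zero).comp (tendsto_rpow_neg_nhdsGT_zero (by norm_num))

lemma tendsto_gttLeading_of_pos_of_lt_one (hp : 0 < p) (hp1 : p < 1) (hx : 0 < x) (hy : y ≠ 0)
    (hA : Tendsto A (𝓝[>] 0) (𝓝 x)) (hB : Tendsto B (𝓝[>] 0) (𝓝 y)) :
    Tendsto (gttLeading k p A B) (𝓝[>] 0) atTop := by
  rw [gttLeading_eq_mul]
  refine Tendsto.const_mul_atTop (by norm_num) (Tendsto.atTop_mul_atTop₀ ?_
    (tendsto_inv_sq_rpow_mul hp hx hA))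
  refine tendsto_atTop_add_const_right _ _ ?_
  simp only [mul_pow]
  refine Tendsto.atTop_mul_pos (C := y ^ 2) (by positivity) ?_ (hB.pow 2)
  exact (tendsto_pow_atTop two_ne_zero).comp (tendsto_rpow_neg_nhdsGT_zero (by linarith))

/-- If `ȧ² + k` has a nonzero limit while `a → 0`, then `G_t̂t̂` diverges. -/
lemma tendsto_gttLeading_of_ne {z : ℝ} (hp : 0 < p) (hx : 0 < x) (hz : z ≠ 0)
    (hA : Tendsto A (𝓝[>] 0) (𝓝 x))
    (hB : Tendsto (fun s => (s ^ (p - 1) * B s) ^ 2 + k) (𝓝[>] 0) (𝓝 z)) :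
    Tendsto (gttLeading k p A B) (𝓝[>] 0) atTop ∨
      Tendsto (gttLeading k p A B) (𝓝[>] 0) atBot := by
  rw [gttLeading_eq_mul]
  have hinv := tendsto_inv_sq_rpow_mul hp hx hA
  rcases hz.lt_or_gt with hz | hz
  · exact Or.inr ((hB.neg_mul_atTop hz hinv).const_mul_atBot (by norm_num))
  · exact Or.inl ((hB.pos_mul_atTop hz hinv).const_mul_atTop (by norm_num))

lemma eventually_gttLeading_zero_eq (hBC : ∀ s : ℝ, 0 < s → s ^ (-1 : ℝ) * B s = s ^ (q - 1) * C s) :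
    ∀ᶠ s in 𝓝[>] (0 : ℝ), gttLeading k 0 A B s =
      3 * ((s ^ (q - 1)) ^ 2 * (C s / A s) ^ 2 + k / A s ^ 2) := by
  filter_upwards [self_mem_nhdsWithin] with s (hs : 0 < s)
  rw [gttLeading, zero_sub, hBC s hs, Real.rpow_zero, one_mul]
  ring

lemma exists_tendsto_gttLeading_zero (hq : 1 ≤ q) (hx : 0 < x)
    (hA : Tendsto A (𝓝[>] 0) (𝓝 x)) (hC : Tendsto C (𝓝[>] 0) (𝓝 y))
    (hBC : ∀ s : ℝ, 0 < s → s ^ (-1 : ℝ) * B s = s ^ (q - 1) * C s) :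
    ∃ L, Tendsto (gttLeading k 0 A B) (𝓝[>] 0) (𝓝 L) := by
  obtain ⟨l, hl⟩ := exists_tendsto_rpow_nhdsGT_zero (sub_nonneg.2 hq)
  simp only [tendsto_congr' (eventually_gttLeading_zero_eq hBC)]
  exact ⟨_, (((hl.pow 2).mul ((hC.div hA hx.ne').pow 2)).add
    ((tendsto_const_nhds (x := k)).div (hA.pow 2) (pow_ne_zero 2 hx.ne'))).const_mul 3⟩

lemma tendsto_gttLeading_zero (hq : q < 1) (hx : 0 < x) (hy : y ≠ 0)
    (hA : Tendsto A (𝓝[>] 0) (𝓝 x)) (hC : Tendsto C (𝓝[>] 0) (𝓝 y))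
    (hBC : ∀ s : ℝ, 0 < s → s ^ (-1 : ℝ) * B s = s ^ (q - 1) * C s) :
    Tendsto (gttLeading k 0 A B) (𝓝[>] 0) atTop := by
  rw [tendsto_congr' (eventually_gttLeading_zero_eq hBC)]
  refine Tendsto.const_mul_atTop (by norm_num) (Tendsto.atTop_add (Tendsto.atTop_mul_pos
    (C := (y / x) ^ 2) (by positivity) ?_ ((hC.div hA hx.ne').pow 2))
    ((tendsto_const_nhds (x := k)).div (hA.pow 2) (pow_ne_zero 2 hx.ne')))
  exact (tendsto_pow_atTop two_ne_zero).comp (tendsto_rpow_neg_nhdsGT_zero (by linarith))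

lemma eventually_gttLeading_one_eq (hBC : ∀ s : ℝ, 0 < s → B s = 1 + s ^ (q - 1) * C s) :
    ∀ᶠ s in 𝓝[>] (0 : ℝ), gttLeading (-1) 1 A B s =
      s ^ (q - 3) * (3 * (C s * (B s + 1) / A s ^ 2)) := by
  filter_upwards [self_mem_nhdsWithin] with s (hs : 0 < s)
  have h1 : s ^ (q - 1) = s ^ (q - 3) * s ^ 2 := by
    rw [← Real.rpow_natCast s 2, ← Real.rpow_add hs]
    congr 1
    push_cast
    ring
  have hB : B s ^ 2 - 1 = s ^ (q - 3) * s ^ 2 * C s * (B s + 1) := by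
    have : B s - 1 = s ^ (q - 3) * s ^ 2 * C s := by rw [hBC s hs, h1]; ring
    rw [← this]
    ring
  have hsum : gttLeading (-1) 1 A B s = 3 * ((B s ^ 2 - 1) / (s * A s) ^ 2) := by
    rw [gttLeading, sub_self, Real.rpow_zero, Real.rpow_one]
    ring
  rw [hsum, hB]
  rcases eq_or_ne (A s) 0 with hA | hA
  · simp [hA]
  · field_simp

lemma exists_tendsto_gttLeading_one {w : ℝ} (hq : 3 ≤ q) (hx : 0 < x)
    (hA : Tendsto A (𝓝[>] 0) (𝓝 x)) (hB : Tendsto B (𝓝[>] 0) (𝓝 w))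
    (hC : Tendsto C (𝓝[>] 0) (𝓝 y))
    (hBC : ∀ s : ℝ, 0 < s → B s = 1 + s ^ (q - 1) * C s) :
    ∃ L, Tendsto (gttLeading (-1) 1 A B) (𝓝[>] 0) (𝓝 L) := by
  obtain ⟨l, hl⟩ := exists_tendsto_rpow_nhdsGT_zero (sub_nonneg.2 hq)
  simp only [tendsto_congr' (eventually_gttLeading_one_eq hBC)]
  exact ⟨_, hl.mul (((hC.mul (hB.add_const 1)).div (hA.pow 2) (pow_ne_zero 2 hx.ne')).const_mul 3)⟩

lemma tendsto_gttLeading_one (hq : q < 3) (hx : 0 < x) (hy : y ≠ 0)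
    (hA : Tendsto A (𝓝[>] 0) (𝓝 x)) (hB : Tendsto B (𝓝[>] 0) (𝓝 1))
    (hC : Tendsto C (𝓝[>] 0) (𝓝 y))
    (hBC : ∀ s : ℝ, 0 < s → B s = 1 + s ^ (q - 1) * C s) :
    Tendsto (gttLeading (-1) 1 A B) (𝓝[>] 0) atTop ∨
      Tendsto (gttLeading (-1) 1 A B) (𝓝[>] 0) atBot := by
  simp only [tendsto_congr' (eventually_gttLeading_one_eq hBC)]
  have hlim := ((hC.mul (hB.add_const 1)).div (hA.pow 2) (pow_ne_zero 2 hx.ne')).const_mul 3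
  have hpow : Tendsto (fun s : ℝ => s ^ (q - 3)) (𝓝[>] 0) atTop :=
    tendsto_rpow_neg_nhdsGT_zero (by linarith)
  have hx2 : 0 < x ^ 2 := by positivity
  rcases hy.lt_or_gt with hy | hy
  · refine Or.inr (hpow.atTop_mul_neg ?_ hlim)
    have := div_neg_of_neg_of_pos (show y * (1 + 1) < 0 by linarith) hx2
    linarith
  · exact Or.inl (hpow.atTop_mul_pos (by positivity) hlim)

end Leading

/-- On the interval where it is a generalized power series, the scale factor may be differentiated
term by term. -/
lemma deriv_eq_sum_rpow {t0 δ : ℝ} {n : ℕ} {η c : ℕ → ℝ} {a : ℝ → ℝ}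
    (ha : ∀ t ∈ Set.Ioo t0 (t0 + δ), a t = ∑ i ∈ Finset.range n, c i * (t - t0) ^ η i)
    {t : ℝ} (ht : t ∈ Set.Ioo t0 (t0 + δ)) :
    deriv a t = ∑ i ∈ Finset.range n, (c i * η i) * (t - t0) ^ (η i - 1) := by
  have heq : a =ᶠ[𝓝 t] fun t => ∑ i ∈ Finset.range n, c i * (t - t0) ^ η i :=
    (eventually_of_mem (Ioo_mem_nhds ht.1 ht.2) ha)
  rw [heq.deriv_eq]
  refine HasDerivAt.deriv (HasDerivAt.fun_sum fun i _ => ?_)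
  have := (((hasDerivAt_id t).sub_const t0).rpow_const (p := η i)
    (Or.inl (sub_pos.2 ht.1).ne')).const_mul (c i)
  refine this.congr_deriv ?_
  simp only [id]
  ring

/-- The `G_t̂t̂ = 3(ȧ²/a² + k/a²)` theorem: for a generalized power-series scale factor
and `k ∈ {−1,0,1}`, the orthonormal Einstein component has a finite one-sided limit
at the milestone iff (i) `η₀ = 0, η₁ ≥ 1`, or (ii) `η₀ = 1, k = −1, c₀ = 1, η₁ ≥ 3`;
in all other cases it diverges to `+∞` or `−∞`. -/
theorem Gtt_finite_limit_iff
    (t0 δ k : ℝ) (N : ℕ) (η c : ℕ → ℝ) (a : ℝ → ℝ)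
    (hN : 2 ≤ N)
    (hδ : 0 < δ)
    (hk : k = -1 ∨ k = 0 ∨ k = 1)
    (hηmono : ∀ i j : ℕ, i < j → j ≤ N → η i < η j)
    (hc0 : 0 < c 0)
    (hcne : ∀ i : ℕ, i ≤ N → c i ≠ 0)
    (ha : ∀ t ∈ Set.Ioo t0 (t0 + δ),
      a t = ∑ i ∈ Finset.range (N + 1), c i * (t - t0) ^ (η i)) :
    ((∃ L : ℝ, Tendsto (fun t => 3 * ((deriv a t) ^ 2 / (a t) ^ 2 + k / (a t) ^ 2))
        (𝓝[>] t0) (𝓝 L)) ↔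
      ((η 0 = 0 ∧ 1 ≤ η 1) ∨ (η 0 = 1 ∧ k = -1 ∧ c 0 = 1 ∧ 3 ≤ η 1))) ∧
    (¬ ((η 0 = 0 ∧ 1 ≤ η 1) ∨ (η 0 = 1 ∧ k = -1 ∧ c 0 = 1 ∧ 3 ≤ η 1)) →
      Tendsto (fun t => 3 * ((deriv a t) ^ 2 / (a t) ^ 2 + k / (a t) ^ 2)) (𝓝[>] t0) atTop ∨
      Tendsto (fun t => 3 * ((deriv a t) ^ 2 / (a t) ^ 2 + k / (a t) ^ 2)) (𝓝[>] t0) atBot) := by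
  have hη01 : η 0 < η 1 := hηmono 0 1 one_pos (by omega)
  obtain ⟨M, rfl⟩ : ∃ M, N = M + 1 := ⟨N - 1, by omega⟩
  obtain ⟨A, hA, hAeq⟩ := exists_rpow_mul_eq_sum (M + 1) η c
    fun i hi hiN => hηmono 0 i hi hiN
  obtain ⟨B, hB, hBeq⟩ := exists_rpow_mul_eq_sum (M + 1) (fun i => η i - 1) (fun i => c i * η i)
    fun i hi hiN => sub_lt_sub_right (hηmono 0 i hi hiN) 1
  obtain ⟨C, hC, hCeq⟩ := exists_rpow_mul_eq_sum M (fun i => η (i + 1) - 1)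
    (fun i => c (i + 1) * η (i + 1))
    fun i hi hiN => sub_lt_sub_right (hηmono (0 + 1) (i + 1) (by omega) (by omega)) 1
  simp only [zero_add] at hC hCeq
  have hBC : ∀ s : ℝ, 0 < s →
      s ^ (η 0 - 1) * B s = c 0 * η 0 * s ^ (η 0 - 1) + s ^ (η 1 - 1) * C s := by
    intro s hs
    rw [← hBeq s hs, ← hCeq s hs, Finset.sum_range_succ', add_comm]
  have hG : ∀ {l : Filter ℝ}, Tendsto (gttLeading k (η 0) A B) (𝓝[>] 0) l →
      Tendsto (fun t => 3 * ((deriv a t) ^ 2 / (a t) ^ 2 + k / (a t) ^ 2)) (𝓝[>] t0) l := by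
    intro l hl
    have hsub : Tendsto (fun t => t - t0) (𝓝[>] t0) (𝓝[>] 0) := by
      refine tendsto_nhdsWithin_iff.2 ⟨?_, ?_⟩
      · have : Tendsto (fun t => t - t0) (𝓝 t0) (𝓝 (t0 - t0)) :=
          (continuous_id.sub continuous_const).tendsto t0
        rw [sub_self] at this
        exact this.mono_left nhdsWithin_le_nhds
      · filter_upwards [self_mem_nhdsWithin] with t (ht : t0 < t) using sub_pos.2 ht
    refine (hl.comp hsub).congr' ?_
    filter_upwards [Ioo_mem_nhdsGT (lt_add_of_pos_right t0 hδ)] with t ht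
    have hs : 0 < t - t0 := sub_pos.2 ht.1
    rw [deriv_eq_sum_rpow ha ht, ha t ht, hAeq _ hs, hBeq _ hs]
    rfl
  have hconv : ((η 0 = 0 ∧ 1 ≤ η 1) ∨ (η 0 = 1 ∧ k = -1 ∧ c 0 = 1 ∧ 3 ≤ η 1)) →
      ∃ L, Tendsto (gttLeading k (η 0) A B) (𝓝[>] 0) (𝓝 L) := by
    rintro (⟨h0, h1⟩ | ⟨h0, rfl, hc1, h1⟩)
    · rw [h0] at hBC ⊢
      exact exists_tendsto_gttLeading_zero h1 hc0 hA hC fun s hs => by simpa using hBC s hs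
    · rw [h0] at hBC ⊢
      exact exists_tendsto_gttLeading_one h1 hc0 hA hB hC fun s hs => by
        simpa [hc1] using hBC s hs
  have hdiv : ¬ ((η 0 = 0 ∧ 1 ≤ η 1) ∨ (η 0 = 1 ∧ k = -1 ∧ c 0 = 1 ∧ 3 ≤ η 1)) →
      Tendsto (gttLeading k (η 0) A B) (𝓝[>] 0) atTop ∨
        Tendsto (gttLeading k (η 0) A B) (𝓝[>] 0) atBot := by
    intro hnot
    have hc1 : c 1 ≠ 0 := hcne 1 (by omega)
    rcases lt_trichotomy (η 0) 0 with h0 | h0 | h0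
    · exact Or.inl (tendsto_gttLeading_of_neg h0 hc0 (mul_ne_zero hc0.ne' h0.ne) hA hB)
    · have h1 : η 1 < 1 := not_le.1 fun h => hnot (Or.inl ⟨h0, h⟩)
      have hy : c 1 * η 1 ≠ 0 := mul_ne_zero hc1 (h0 ▸ hη01).ne'
      rw [h0] at hBC ⊢
      exact Or.inl (tendsto_gttLeading_zero h1 hc0 hy hA hC fun s hs => by simpa using hBC s hs)
    have hy0 : c 0 * η 0 ≠ 0 := mul_ne_zero hc0.ne' h0.ne'
    rcases lt_trichotomy (η 0) 1 with h1 | h1 | h1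
    · exact Or.inl (tendsto_gttLeading_of_pos_of_lt_one h0 h1 hc0 hy0 hA hB)
    · by_cases hz : c 0 ^ 2 + k = 0
      · have hk1 : k = -1 := by
          rcases hk with h | h | h
          · exact h
          all_goals nlinarith [pow_pos hc0 2]
        have hc : c 0 = 1 := by
          subst hk1
          nlinarith
        have hη3 : η 1 < 3 := not_le.1 fun h => hnot (Or.inr ⟨h1, hk1, hc, h⟩)
        have hy : c 1 * η 1 ≠ 0 := mul_ne_zero hc1 (h0.trans hη01).ne'
        rw [h1] at hBC hB ⊢
        rw [hc, one_mul] at hB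
        rw [hk1]
        exact tendsto_gttLeading_one hη3 hc0 hy hA hB hC fun s hs => by
          simpa [hc] using hBC s hs
      · refine tendsto_gttLeading_of_ne h0 hc0 hz hA ?_
        simpa [h1] using (hB.pow 2).add_const k
    · by_cases hk0 : k = 0
      · rw [hk0]
        exact Or.inl (tendsto_gttLeading_of_flat hc0 hy0 hA hB)
      · refine tendsto_gttLeading_of_ne h0 hc0 hk0 hA ?_
        simpa using
          (((tendsto_rpow_nhdsGT_zero_of_pos (sub_pos.2 h1)).mul hB).pow 2).add_const k
  refine ⟨⟨fun ⟨L, hL⟩ => ?_, fun h => (hconv h).imp fun _ => hG⟩,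
    fun h => (hdiv h).imp hG hG⟩
  by_contra hnot
  rcases hdiv hnot with h | h
  · exact not_tendsto_nhds_of_tendsto_atTop (hG h) L hL
  · exact not_tendsto_nhds_of_tendsto_atBot (hG h) L hL
end

section
/- For the generalized power-series scale factor a, the following are equivalent: (i) for every positive integer n, the n-th derivative a⁽ⁿ⁾(t) converges to a finite real limit as t → t⊙ from the right; (ii) every exponent ηᵢ (0 ≤ i ≤ N) is a nonnegative integer. (This is the key step in showing that a cosmological milestone fails to be a derivative curvature singularity only when the scale factor is an ordinary Taylor series at t⊙.) -/
open Filter Topology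

/-- Termwise formula for the iterated derivatives of a finite sum of real powers. -/
theorem iteratedDeriv_eq_sum_rpow {ι : Type*} {s : Finset ι} {t0 b : ℝ} {η c : ι → ℝ}
    {a : ℝ → ℝ} (ha : ∀ t ∈ Set.Ioo t0 b, a t = ∑ i ∈ s, c i * (t - t0) ^ η i) (n : ℕ) :
    ∀ t ∈ Set.Ioo t0 b, iteratedDeriv n a t =
      ∑ i ∈ s, c i * (∏ j ∈ Finset.range n, (η i - j)) * (t - t0) ^ (η i - n) := by
  induction n with
  | zero => simpa using ha
  | succ n ih =>
    intro t ht
    have heq : iteratedDeriv n a =ᶠ[𝓝 t] fun t =>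
        ∑ i ∈ s, c i * (∏ j ∈ Finset.range n, (η i - j)) * (t - t0) ^ (η i - n) := by
      filter_upwards [isOpen_Ioo.mem_nhds ht] with u hu using ih u hu
    rw [iteratedDeriv_succ, heq.deriv_eq]
    refine HasDerivAt.deriv (HasDerivAt.fun_sum fun i _ => ?_)
    have h := (((hasDerivAt_id t).sub_const t0).rpow_const (p := η i - n)
      (Or.inl (sub_pos.2 ht.1).ne')).const_mul (c i * ∏ j ∈ Finset.range n, (η i - j))
    refine h.congr_deriv ?_
    rw [Finset.prod_range_succ]
    push_cast
    simp only [id, sub_sub]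
    ring

theorem tendsto_sub_rpow_nhdsGT (t0 : ℝ) {p : ℝ} (hp : 0 ≤ p) :
    Tendsto (fun t => (t - t0) ^ p) (𝓝[>] t0) (𝓝 (0 ^ p)) := by
  have h : Continuous fun t : ℝ => (t - t0) ^ p :=
    (continuous_id.sub continuous_const).rpow_const fun _ => Or.inr hp
  simpa using (h.tendsto t0).mono_left nhdsWithin_le_nhds

theorem prod_range_natCast_sub_eq_zero {m n : ℕ} (h : m < n) :
    ∏ j ∈ Finset.range n, ((m : ℝ) - j) = 0 :=
  Finset.prod_eq_zero (Finset.mem_range.2 h) (sub_self _)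

/-- Derivative curvature singularity criterion (key step): for a generalized
power-series scale factor, every derivative `a⁽ⁿ⁾` (`n ≥ 1`) has a finite
one-sided limit at the milestone iff every exponent `ηᵢ` is a nonnegative
integer (i.e. the scale factor is an ordinary Taylor series at `t⊙`). -/
theorem all_derivatives_finite_iff_exponents_nonneg_integers
    (t0 δ : ℝ) (N : ℕ) (η c : ℕ → ℝ) (a : ℝ → ℝ)
    (hδ : 0 < δ)
    (hηmono : ∀ i j : ℕ, i < j → j ≤ N → η i < η j)
    (hc0 : 0 < c 0)
    (hcne : ∀ i : ℕ, i ≤ N → c i ≠ 0)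
    (ha : ∀ t ∈ Set.Ioo t0 (t0 + δ),
      a t = ∑ i ∈ Finset.range (N + 1), c i * (t - t0) ^ (η i)) :
    (∀ n : ℕ, 0 < n →
      ∃ L : ℝ, Tendsto (fun t => iteratedDeriv n a t) (𝓝[>] t0) (𝓝 L)) ↔
    (∀ i : ℕ, i ≤ N → ∃ m : ℕ, η i = (m : ℝ)) := by
  have hI : Set.Ioo t0 (t0 + δ) ∈ 𝓝[>] t0 := Ioo_mem_nhdsGT (by linarith)
  have hD := iteratedDeriv_eq_sum_rpow ha
  constructor
  · intro h
    by_contra hne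
    classical
    have hex : ∃ k, k ≤ N ∧ ∀ m : ℕ, η k ≠ m := by
      push Not at hne
      exact hne
    obtain ⟨hkN, hk⟩ := Nat.find_spec hex
    have hmin : ∀ i < Nat.find hex, ∃ m : ℕ, η i = m := by
      intro i hi
      have := Nat.find_min hex hi
      push Not at this
      exact this (by omega)
    generalize Nat.find hex = k at hkN hk hmin
    obtain ⟨n, hn⟩ := exists_nat_gt (max (η k) 0)
    have hnk : η k < n := (le_max_left _ _).trans_lt hn
    have hn0 : 0 < n := by exact_mod_cast (le_max_right _ _).trans_lt hn
    obtain ⟨L, hL⟩ := h n hn0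
    set C : ℕ → ℝ := fun i => c i * ∏ j ∈ Finset.range n, (η i - j) with hC
    have hlim0 : Tendsto (fun t => iteratedDeriv n a t * (t - t0) ^ (n - η k)) (𝓝[>] t0)
        (𝓝 0) := by
      have := hL.mul (tendsto_sub_rpow_nhdsGT t0 (sub_pos.2 hnk).le)
      rwa [Real.zero_rpow (sub_pos.2 hnk).ne', mul_zero] at this
    have hterm : ∀ i ∈ Finset.range (N + 1), Tendsto (fun t => C i * (t - t0) ^ (η i - η k))
        (𝓝[>] t0) (𝓝 (if i = k then C k else 0)) := by
      intro i hi
      have hiN : i ≤ N := by simpa [Nat.lt_succ_iff] using hi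
      rcases lt_trichotomy i k with hik | rfl | hik
      · obtain ⟨m, hm⟩ := hmin i hik
        have hmn : m < n := by
          have := hηmono i k hik hkN
          rw [hm] at this
          exact_mod_cast this.trans hnk
        have : C i = 0 := by simp only [hC, hm, prod_range_natCast_sub_eq_zero hmn, mul_zero]
        simp [this, hik.ne]
      · simp
      · have hpos : 0 < η i - η k := sub_pos.2 (hηmono k i hik hiN)
        have := (tendsto_sub_rpow_nhdsGT t0 hpos.le).const_mul (C i)
        rw [if_neg hik.ne']
        rwa [Real.zero_rpow hpos.ne', mul_zero] at this
    have hlimC : Tendsto (fun t => iteratedDeriv n a t * (t - t0) ^ (n - η k)) (𝓝[>] t0)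
        (𝓝 (C k)) := by
      have hsum := tendsto_finsetSum _ hterm
      rw [Finset.sum_ite_eq' (Finset.range (N + 1)) k fun _ => C k,
        if_pos (Finset.mem_range.2 (by omega))] at hsum
      refine hsum.congr' ?_
      filter_upwards [hI] with t ht
      rw [hD n t ht, Finset.sum_mul]
      refine Finset.sum_congr rfl fun i _ => ?_
      rw [mul_assoc (c i * _), ← Real.rpow_add (sub_pos.2 ht.1), sub_add_sub_cancel]
    have hCk : C k ≠ 0 :=
      mul_ne_zero (hcne k hkN) (Finset.prod_ne_zero_iff.2 fun j _ => sub_ne_zero.2 (hk j))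
    exact hCk (tendsto_nhds_unique hlimC hlim0)
  · intro h n _
    have hterm : ∀ i ∈ Finset.range (N + 1), ∃ l : ℝ, Tendsto
        (fun t => c i * (∏ j ∈ Finset.range n, (η i - j)) * (t - t0) ^ (η i - n))
        (𝓝[>] t0) (𝓝 l) := by
      intro i hi
      obtain ⟨m, hm⟩ := h i (by simpa [Nat.lt_succ_iff] using hi)
      rw [hm]
      rcases lt_or_ge m n with hmn | hmn
      · exact ⟨0, by simp [prod_range_natCast_sub_eq_zero hmn]⟩
      · have hp : (0 : ℝ) ≤ m - n := sub_nonneg.2 (by exact_mod_cast hmn)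
        exact ⟨_, (tendsto_sub_rpow_nhdsGT t0 hp).const_mul _⟩
    choose! l hl using hterm
    refine ⟨∑ i ∈ Finset.range (N + 1), l i, (tendsto_finsetSum _ hl).congr' ?_⟩
    filter_upwards [hI] with t ht using (hD n t ht).symm
end

section
/- Suppose N ≥ 2. The quantity −(a(t)·ä(t) + 2ȧ(t)²)/2 has the following one-sided limit as t → t⊙ from the right: 0 if η₀ > 1; −c₀² if η₀ = 1; −∞ if 1/3 < η₀ < 1; 0 if η₀ = 1/3 and η₁ > 5/3; −(14/9)c₀c₁ if η₀ = 1/3 and η₁ = 5/3; −∞ if η₀ = 1/3, η₁ < 5/3 and c₁ > 0, and +∞ if c₁ < 0 in that case; +∞ if 0 < η₀ < 1/3; 0 if η₀ = 0 and η₁ > 2; −c₀c₁ if η₀ = 0 and η₁ = 2; −∞ if η₀ = 0, 1 < η₁ < 2 and c₁ > 0, and +∞ if c₁ < 0 in that case; −c₁² if η₀ = 0, η₁ = 1 and η₂ > 2; −c₀c₂ − c₁² if η₀ = 0, η₁ = 1 and η₂ = 2; −∞ if η₀ = 0, η₁ = 1, 1 < η₂ < 2 and c₂ > 0, and +∞ if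 c₂ < 0 in that case; +∞ if η₀ = 0, 0 < η₁ < 1 and c₁ > 0, and −∞ if c₁ < 0 in that case; −∞ if η₀ < 0. (The dominant energy condition at the milestone requires k ≥ −(a ä + 2ȧ²)/2 in addition to the NEC, so this limit controls DEC satisfaction or violation.) -/
open Filter Topology

/-- Termwise derivative of a finite sum of real powers on a right neighbourhood. -/
theorem deriv_eq_sum_rpow_s12 {ι : Type*} {s : Finset ι} {b e : ι → ℝ} {f : ℝ → ℝ} {t0 r : ℝ}
    (hf : ∀ t ∈ Set.Ioo t0 r, f t = ∑ i ∈ s, b i * (t - t0) ^ e i) :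
    ∀ t ∈ Set.Ioo t0 r, deriv f t = ∑ i ∈ s, b i * e i * (t - t0) ^ (e i - 1) := by
  intro t ht
  have hpos : t - t0 ≠ 0 := (sub_pos.2 ht.1).ne'
  have hsum : HasDerivAt (fun u => ∑ i ∈ s, b i * (u - t0) ^ e i)
      (∑ i ∈ s, b i * e i * (t - t0) ^ (e i - 1)) t := by
    refine HasDerivAt.fun_sum fun i _ => ?_
    have h := (((hasDerivAt_id t).sub_const t0).rpow_const (p := e i) (Or.inl hpos)).const_mul (b i)
    exact h.congr_deriv (by simp only [id]; ring)
  have heq : f =ᶠ[𝓝 t] fun u => ∑ i ∈ s, b i * (u - t0) ^ e i :=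
    Filter.eventually_of_mem (Ioo_mem_nhds ht.1 ht.2) hf
  exact (hsum.congr_of_eventuallyEq heq).deriv

/-- The terms of `∑ p ∈ s, A p * x ^ E p` that matter at leading order as `x → 0⁺` are those with
index in `T`, which all have exponent `e`. -/
structure IsDominant {ι : Type*} (s T : Finset ι) (A E : ι → ℝ) (e : ℝ) : Prop where
  subset : T ⊆ s
  eq : ∀ p ∈ T, E p = e
  lt : ∀ p ∈ s, p ∉ T → A p = 0 ∨ e < E p

theorem tendsto_rpow_nhdsGT_zero {e : ℝ} (he : 0 < e) :
    Tendsto (fun x : ℝ => x ^ e) (𝓝[>] 0) (𝓝 0) := by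
  have h := (Real.continuousAt_rpow_const 0 e (Or.inr he.le)).tendsto
  rw [Real.zero_rpow he.ne'] at h
  exact h.mono_left nhdsWithin_le_nhds

theorem sum_rpow_eventuallyEq {ι : Type*} (s : Finset ι) (A E : ι → ℝ) (e : ℝ) :
    (fun x : ℝ => x ^ e * ∑ p ∈ s, A p * x ^ (E p - e)) =ᶠ[𝓝[>] 0]
      fun x => ∑ p ∈ s, A p * x ^ E p := by
  filter_upwards [self_mem_nhdsWithin] with x (hx : 0 < x)
  rw [Finset.mul_sum]
  refine Finset.sum_congr rfl fun p _ => ?_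
  rw [mul_left_comm, ← Real.rpow_add hx, add_sub_cancel]

namespace IsDominant

variable {ι : Type*} {s T : Finset ι} {A E : ι → ℝ} {e : ℝ}

theorem tendsto_sum_rpow_sub (h : IsDominant s T A E e) :
    Tendsto (fun x : ℝ => ∑ p ∈ s, A p * x ^ (E p - e)) (𝓝[>] 0) (𝓝 (∑ p ∈ T, A p)) := by
  classical
  have hlim : ∑ p ∈ T, A p = ∑ p ∈ s, if p ∈ T then A p else 0 := by
    rw [Finset.sum_ite_mem, Finset.inter_eq_right.2 h.subset]
  rw [hlim]
  refine tendsto_finsetSum _ fun p hp => ?_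
  by_cases hpT : p ∈ T
  · simp [hpT, h.eq p hpT]
  · rw [if_neg hpT]
    rcases h.lt p hp hpT with h0 | hlt
    · simp [h0]
    · simpa using (tendsto_rpow_nhdsGT_zero (sub_pos.2 hlt)).const_mul (A p)

theorem tendsto_sum_rpow_zero (h : IsDominant s T A E e) (he : 0 < e) :
    Tendsto (fun x : ℝ => ∑ p ∈ s, A p * x ^ E p) (𝓝[>] 0) (𝓝 0) := by
  simpa using ((tendsto_rpow_nhdsGT_zero he).mul h.tendsto_sum_rpow_sub).congr'
    (sum_rpow_eventuallyEq s A E e)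

theorem tendsto_sum_rpow_nhds (h : IsDominant s T A E e) (he : e = 0) :
    Tendsto (fun x : ℝ => ∑ p ∈ s, A p * x ^ E p) (𝓝[>] 0) (𝓝 (∑ p ∈ T, A p)) := by
  simpa [he] using h.tendsto_sum_rpow_sub

theorem tendsto_sum_rpow_atTop (h : IsDominant s T A E e) (he : e < 0) (hA : 0 < ∑ p ∈ T, A p) :
    Tendsto (fun x : ℝ => ∑ p ∈ s, A p * x ^ E p) (𝓝[>] 0) atTop :=
  ((tendsto_rpow_neg_nhdsGT_zero he).atTop_mul_pos hA h.tendsto_sum_rpow_sub).congr'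
    (sum_rpow_eventuallyEq s A E e)

theorem tendsto_sum_rpow_atBot (h : IsDominant s T A E e) (he : e < 0) (hA : ∑ p ∈ T, A p < 0) :
    Tendsto (fun x : ℝ => ∑ p ∈ s, A p * x ^ E p) (𝓝[>] 0) atBot :=
  ((tendsto_rpow_neg_nhdsGT_zero he).atTop_mul_neg hA h.tendsto_sum_rpow_sub).congr'
    (sum_rpow_eventuallyEq s A E e)

end IsDominant

/-- The coefficient of `(t - t0) ^ (η i + η j - 2)` in `-(a ä + 2 ȧ²) / 2`, symmetrized in
`i` and `j`. -/
noncomputable def decCoeff (η c : ℕ → ℝ) (p : ℕ × ℕ) : ℝ :=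
  -(η p.1 * (η p.1 - 1) + η p.2 * (η p.2 - 1) + 4 * η p.1 * η p.2) / 4 * (c p.1 * c p.2)

theorem dec_combination_eq_sum (s : Finset ℕ) (η c : ℕ → ℝ) {x : ℝ} (hx : 0 < x) :
    -((∑ i ∈ s, c i * x ^ η i) * (∑ i ∈ s, c i * η i * (η i - 1) * x ^ (η i - 1 - 1)) +
        2 * (∑ i ∈ s, c i * η i * x ^ (η i - 1)) ^ 2) / 2 =
      ∑ p ∈ s ×ˢ s, decCoeff η c p * x ^ (η p.1 + η p.2 - 2) := by
  set u := ∑ i ∈ s, c i * x ^ η i with hu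
  set w := ∑ i ∈ s, c i * η i * (η i - 1) * x ^ (η i - 1 - 1) with hw
  set v := ∑ i ∈ s, c i * η i * x ^ (η i - 1) with hv
  have hsplit : -(u * w + 2 * v ^ 2) / 2 = -(u * w) / 4 - w * u / 4 - v * v := by ring
  rw [hsplit, hu, hw, hv]
  simp only [Finset.sum_mul_sum, ← Finset.sum_product', neg_div, Finset.sum_div,
    ← Finset.sum_neg_distrib, ← Finset.sum_sub_distrib]
  refine Finset.sum_congr rfl fun p _ => ?_
  have h1 : x ^ (η p.1 + η p.2 - 2) = x ^ η p.1 * x ^ η p.2 * x⁻¹ * x⁻¹ := by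
    rw [show η p.1 + η p.2 - 2 = η p.1 + η p.2 - 1 - 1 by ring, Real.rpow_sub_one hx.ne',
      Real.rpow_sub_one hx.ne', Real.rpow_add hx]
    ring
  simp only [h1, Real.rpow_sub_one hx.ne', decCoeff]
  ring

theorem dec_combination_eventuallyEq {t0 δ : ℝ} {s : Finset ℕ} {η c : ℕ → ℝ} {a : ℝ → ℝ}
    (hδ : 0 < δ) (ha : ∀ t ∈ Set.Ioo t0 (t0 + δ), a t = ∑ i ∈ s, c i * (t - t0) ^ η i) :
    ((fun x => ∑ p ∈ s ×ˢ s, decCoeff η c p * x ^ (η p.1 + η p.2 - 2)) ∘ fun t => t - t0)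
      =ᶠ[𝓝[>] t0] fun t => -(a t * deriv (deriv a) t + 2 * (deriv a t) ^ 2) / 2 := by
  have hd := deriv_eq_sum_rpow_s12 ha
  have hdd := deriv_eq_sum_rpow_s12 hd
  filter_upwards [Ioo_mem_nhdsGT (lt_add_of_pos_right t0 hδ)] with t ht
  rw [ha t ht, hd t ht, hdd t ht, dec_combination_eq_sum s η c (sub_pos.2 ht.1)]
  rfl

/-- One-sided limit of `−(a ä + 2ȧ²)/2` at a generic cosmological milestone described
by a generalized power-series scale factor.  (The DEC at the milestone requires
`k ≥ −(a ä + 2ȧ²)/2` in addition to the NEC, so this limit controls DEC satisfaction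
or violation.) -/
theorem limit_of_DEC_combination
    (t0 δ : ℝ) (N : ℕ) (η c : ℕ → ℝ) (a : ℝ → ℝ)
    (hN : 2 ≤ N)
    (hδ : 0 < δ)
    (hηmono : ∀ i j : ℕ, i < j → j ≤ N → η i < η j)
    (hc0 : 0 < c 0)
    (hcne : ∀ i : ℕ, i ≤ N → c i ≠ 0)
    (ha : ∀ t ∈ Set.Ioo t0 (t0 + δ),
      a t = ∑ i ∈ Finset.range (N + 1), c i * (t - t0) ^ (η i)) :
    (1 < η 0 →
      Tendsto (fun t => -(a t * deriv (deriv a) t + 2 * (deriv a t) ^ 2) / 2)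
        (𝓝[>] t0) (𝓝 0)) ∧
    (η 0 = 1 →
      Tendsto (fun t => -(a t * deriv (deriv a) t + 2 * (deriv a t) ^ 2) / 2)
        (𝓝[>] t0) (𝓝 (-(c 0) ^ 2))) ∧
    (1 / 3 < η 0 ∧ η 0 < 1 →
      Tendsto (fun t => -(a t * deriv (deriv a) t + 2 * (deriv a t) ^ 2) / 2)
        (𝓝[>] t0) atBot) ∧
    (η 0 = 1 / 3 ∧ 5 / 3 < η 1 →
      Tendsto (fun t => -(a t * deriv (deriv a) t + 2 * (deriv a t) ^ 2) / 2)
        (𝓝[>] t0) (𝓝 0)) ∧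
    (η 0 = 1 / 3 ∧ η 1 = 5 / 3 →
      Tendsto (fun t => -(a t * deriv (deriv a) t + 2 * (deriv a t) ^ 2) / 2)
        (𝓝[>] t0) (𝓝 (-(14 / 9) * c 0 * c 1))) ∧
    (η 0 = 1 / 3 ∧ η 1 < 5 / 3 →
      (0 < c 1 →
        Tendsto (fun t => -(a t * deriv (deriv a) t + 2 * (deriv a t) ^ 2) / 2)
          (𝓝[>] t0) atBot) ∧
      (c 1 < 0 →
        Tendsto (fun t => -(a t * deriv (deriv a) t + 2 * (deriv a t) ^ 2) / 2)
          (𝓝[>] t0) atTop)) ∧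
    (0 < η 0 ∧ η 0 < 1 / 3 →
      Tendsto (fun t => -(a t * deriv (deriv a) t + 2 * (deriv a t) ^ 2) / 2)
        (𝓝[>] t0) atTop) ∧
    (η 0 = 0 ∧ 2 < η 1 →
      Tendsto (fun t => -(a t * deriv (deriv a) t + 2 * (deriv a t) ^ 2) / 2)
        (𝓝[>] t0) (𝓝 0)) ∧
    (η 0 = 0 ∧ η 1 = 2 →
      Tendsto (fun t => -(a t * deriv (deriv a) t + 2 * (deriv a t) ^ 2) / 2)
        (𝓝[>] t0) (𝓝 (-(c 0 * c 1)))) ∧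
    (η 0 = 0 ∧ 1 < η 1 ∧ η 1 < 2 →
      (0 < c 1 →
        Tendsto (fun t => -(a t * deriv (deriv a) t + 2 * (deriv a t) ^ 2) / 2)
          (𝓝[>] t0) atBot) ∧
      (c 1 < 0 →
        Tendsto (fun t => -(a t * deriv (deriv a) t + 2 * (deriv a t) ^ 2) / 2)
          (𝓝[>] t0) atTop)) ∧
    (η 0 = 0 ∧ η 1 = 1 ∧ 2 < η 2 →
      Tendsto (fun t => -(a t * deriv (deriv a) t + 2 * (deriv a t) ^ 2) / 2)
        (𝓝[>] t0) (𝓝 (-(c 1) ^ 2))) ∧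
    (η 0 = 0 ∧ η 1 = 1 ∧ η 2 = 2 →
      Tendsto (fun t => -(a t * deriv (deriv a) t + 2 * (deriv a t) ^ 2) / 2)
        (𝓝[>] t0) (𝓝 (-(c 0 * c 2) - (c 1) ^ 2))) ∧
    (η 0 = 0 ∧ η 1 = 1 ∧ 1 < η 2 ∧ η 2 < 2 →
      (0 < c 2 →
        Tendsto (fun t => -(a t * deriv (deriv a) t + 2 * (deriv a t) ^ 2) / 2)
          (𝓝[>] t0) atBot) ∧
      (c 2 < 0 →
        Tendsto (fun t => -(a t * deriv (deriv a) t + 2 * (deriv a t) ^ 2) / 2)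
          (𝓝[>] t0) atTop)) ∧
    (η 0 = 0 ∧ 0 < η 1 ∧ η 1 < 1 →
      (0 < c 1 →
        Tendsto (fun t => -(a t * deriv (deriv a) t + 2 * (deriv a t) ^ 2) / 2)
          (𝓝[>] t0) atTop) ∧
      (c 1 < 0 →
        Tendsto (fun t => -(a t * deriv (deriv a) t + 2 * (deriv a t) ^ 2) / 2)
          (𝓝[>] t0) atBot)) ∧
    (η 0 < 0 →
      Tendsto (fun t => -(a t * deriv (deriv a) t + 2 * (deriv a t) ^ 2) / 2)
        (𝓝[>] t0) atBot) := by
  have hsub : Tendsto (fun t => t - t0) (𝓝[>] t0) (𝓝[>] 0) := by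
    refine tendsto_nhdsWithin_iff.2 ⟨?_, ?_⟩
    · have h : Tendsto (fun t => t - t0) (𝓝 t0) (𝓝 (t0 - t0)) :=
        (continuous_id.sub continuous_const).tendsto t0
      rw [sub_self] at h
      exact h.mono_left nhdsWithin_le_nhds
    · filter_upwards [self_mem_nhdsWithin] with t ht
      exact sub_pos.2 (Set.mem_Ioi.1 ht)
  have hlim : ∀ l : Filter ℝ,
      Tendsto (fun x => ∑ p ∈ Finset.range (N + 1) ×ˢ Finset.range (N + 1),
        decCoeff η c p * x ^ (η p.1 + η p.2 - 2)) (𝓝[>] 0) l →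
      Tendsto (fun t => -(a t * deriv (deriv a) t + 2 * (deriv a t) ^ 2) / 2) (𝓝[>] t0) l :=
    fun l h => (h.comp hsub).congr' (dec_combination_eventuallyEq hδ ha)
  set s := Finset.range (N + 1) ×ˢ Finset.range (N + 1) with hs
  set A := decCoeff η c with hA
  set E : ℕ × ℕ → ℝ := fun p => η p.1 + η p.2 - 2 with hE
  have h01 : η 0 < η 1 := hηmono 0 1 (by lia) (by lia)
  have h12 : η 1 < η 2 := hηmono 1 2 (by lia) hN
  have hindex : ∀ i ∈ Finset.range (N + 1), i = 0 ∨ i = 1 ∨ i = 2 ∨ η 2 < η i := by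
    intro i hi
    have hiN := Finset.mem_range.1 hi
    by_cases h : 2 < i
    · exact Or.inr (Or.inr (Or.inr (hηmono 2 i h (by lia))))
    · lia
  have hpairs : ∀ T : Finset (ℕ × ℕ), (∀ p ∈ T, p.1 ≤ 2 ∧ p.2 ≤ 2) → T ⊆ s := by
    intro T hT p hp
    have := hT p hp
    simp only [hs, Finset.mem_product, Finset.mem_range]
    lia
  have hdom00 : IsDominant s {(0, 0)} A E (2 * η 0 - 2) := by
    refine ⟨hpairs _ (by simp), by simp [hE, two_mul], ?_⟩
    rintro ⟨i, j⟩ hp hpT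
    obtain ⟨hi, hj⟩ := Finset.mem_product.1 hp
    rcases hindex i hi with rfl | rfl | rfl | hi' <;>
      rcases hindex j hj with rfl | rfl | rfl | hj' <;>
      first
        | (right; simp only [hE]; linarith)
        | simp at hpT
  have hdom01 : A (0, 0) = 0 → IsDominant s {(0, 1), (1, 0)} A E (η 0 + η 1 - 2) := by
    intro h00
    refine ⟨hpairs _ (by simp), by simp [hE, add_comm], ?_⟩
    rintro ⟨i, j⟩ hp hpT
    obtain ⟨hi, hj⟩ := Finset.mem_product.1 hp
    rcases hindex i hi with rfl | rfl | rfl | hi' <;>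
      rcases hindex j hj with rfl | rfl | rfl | hj' <;>
      first
        | (right; simp only [hE]; linarith)
        | exact Or.inl h00
        | simp at hpT
  have hdom02 : η 0 = 0 → η 1 = 1 → η 2 < 2 → IsDominant s {(0, 2), (2, 0)} A E (η 2 - 2) := by
    intro h0 h1 h2
    refine ⟨hpairs _ (by simp), by simp [hE, h0], ?_⟩
    rintro ⟨i, j⟩ hp hpT
    obtain ⟨hi, hj⟩ := Finset.mem_product.1 hp
    rcases hindex i hi with rfl | rfl | rfl | hi' <;>
      rcases hindex j hj with rfl | rfl | rfl | hj' <;>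
      first
        | (right; simp only [hE]; linarith)
        | (left; simp only [hA, decCoeff, h0, h1]; norm_num; done)
        | simp at hpT
  have hdom11 : η 0 = 0 → η 1 = 1 → 2 < η 2 → IsDominant s {(1, 1)} A E 0 := by
    intro h0 h1 h2
    refine ⟨hpairs _ (by simp), by norm_num [hE, h1], ?_⟩
    rintro ⟨i, j⟩ hp hpT
    obtain ⟨hi, hj⟩ := Finset.mem_product.1 hp
    rcases hindex i hi with rfl | rfl | rfl | hi' <;>
      rcases hindex j hj with rfl | rfl | rfl | hj' <;>
      first
        | (right; simp only [hE]; linarith)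
        | (left; simp only [hA, decCoeff, h0, h1]; norm_num; done)
        | simp at hpT
  have hdom022 : η 0 = 0 → η 1 = 1 → η 2 = 2 → IsDominant s {(0, 2), (2, 0), (1, 1)} A E 0 := by
    intro h0 h1 h2
    refine ⟨hpairs _ (by simp), by norm_num [hE, h0, h1, h2], ?_⟩
    rintro ⟨i, j⟩ hp hpT
    obtain ⟨hi, hj⟩ := Finset.mem_product.1 hp
    rcases hindex i hi with rfl | rfl | rfl | hi' <;>
      rcases hindex j hj with rfl | rfl | rfl | hj' <;>
      first
        | (right; simp only [hE]; linarith)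
        | (left; simp only [hA, decCoeff, h0, h1]; norm_num; done)
        | simp at hpT
  have hsum00 : ∑ p ∈ {(0, 0)}, A p = -(η 0 * (3 * η 0 - 1) * c 0 ^ 2 / 2) := by
    rw [Finset.sum_singleton]
    simp only [hA, decCoeff]
    ring
  have hsum01 : ∑ p ∈ {(0, 1), (1, 0)}, A p =
      -((η 1 * (η 1 - 1) + η 0 * (η 0 - 1) + 4 * η 0 * η 1) * c 0 / 2 * c 1) := by
    rw [Finset.sum_pair (by simp)]
    simp only [hA, decCoeff]
    ring
  have hsum02 : η 0 = 0 → ∑ p ∈ {(0, 2), (2, 0)}, A p = -(η 2 * (η 2 - 1) * c 0 / 2 * c 2) := by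
    intro h0
    rw [Finset.sum_pair (by simp)]
    simp only [hA, decCoeff, h0]
    ring
  have hsum11 : η 1 = 1 → ∑ p ∈ {(1, 1)}, A p = -(c 1) ^ 2 := by
    intro h1
    rw [Finset.sum_singleton]
    simp only [hA, decCoeff, h1]
    ring
  have hzero00 : η 0 = 0 ∨ η 0 = 1 / 3 → A (0, 0) = 0 := by
    rintro (h0 | h0) <;> simp only [hA, decCoeff, h0] <;> norm_num
  have hsq : 0 < c 0 ^ 2 := pow_pos hc0 2
  refine ⟨?_, ?_, ?_, ?_, ?_, ?_, ?_, ?_, ?_, ?_, ?_, ?_, ?_, ?_, ?_⟩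
  · intro h0
    exact hlim _ (hdom00.tendsto_sum_rpow_zero (by linarith))
  · intro h0
    have hval : -(c 0) ^ 2 = ∑ p ∈ {(0, 0)}, A p := by
      rw [hsum00, h0]
      ring
    rw [hval]
    exact hlim _ (hdom00.tendsto_sum_rpow_nhds (by linarith))
  · rintro ⟨h0, h0'⟩
    have hK : 0 < η 0 * (3 * η 0 - 1) := by nlinarith
    refine hlim _ (hdom00.tendsto_sum_rpow_atBot (by linarith) ?_)
    rw [hsum00]
    exact neg_lt_zero.2 (by positivity)
  · rintro ⟨h0, h1⟩
    exact hlim _ ((hdom01 (hzero00 (Or.inr h0))).tendsto_sum_rpow_zero (by linarith))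
  · rintro ⟨h0, h1⟩
    have hval : -(14 / 9) * c 0 * c 1 = ∑ p ∈ {(0, 1), (1, 0)}, A p := by
      rw [hsum01, h0, h1]
      ring
    rw [hval]
    exact hlim _ ((hdom01 (hzero00 (Or.inr h0))).tendsto_sum_rpow_nhds (by linarith))
  · rintro ⟨h0, h1⟩
    have hK : 0 < (η 1 * (η 1 - 1) + η 0 * (η 0 - 1) + 4 * η 0 * η 1) * c 0 / 2 :=
      half_pos (mul_pos (by nlinarith) hc0)
    have hdom := hdom01 (hzero00 (Or.inr h0))
    refine ⟨fun hc => hlim _ (hdom.tendsto_sum_rpow_atBot (by linarith) ?_),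
      fun hc => hlim _ (hdom.tendsto_sum_rpow_atTop (by linarith) ?_)⟩ <;> rw [hsum01]
    · exact neg_lt_zero.2 (mul_pos hK hc)
    · exact neg_pos.2 (mul_neg_of_pos_of_neg hK hc)
  · rintro ⟨h0, h0'⟩
    have hK : η 0 * (3 * η 0 - 1) < 0 := by nlinarith
    refine hlim _ (hdom00.tendsto_sum_rpow_atTop (by linarith) ?_)
    rw [hsum00]
    exact neg_pos.2 (by nlinarith [mul_neg_of_neg_of_pos hK hsq])
  · rintro ⟨h0, h1⟩
    exact hlim _ ((hdom01 (hzero00 (Or.inl h0))).tendsto_sum_rpow_zero (by linarith))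
  · rintro ⟨h0, h1⟩
    have hval : -(c 0 * c 1) = ∑ p ∈ {(0, 1), (1, 0)}, A p := by
      rw [hsum01, h0, h1]
      ring
    rw [hval]
    exact hlim _ ((hdom01 (hzero00 (Or.inl h0))).tendsto_sum_rpow_nhds (by linarith))
  · rintro ⟨h0, h1, h1'⟩
    have hK : 0 < (η 1 * (η 1 - 1) + η 0 * (η 0 - 1) + 4 * η 0 * η 1) * c 0 / 2 :=
      half_pos (mul_pos (by nlinarith) hc0)
    have hdom := hdom01 (hzero00 (Or.inl h0))
    refine ⟨fun hc => hlim _ (hdom.tendsto_sum_rpow_atBot (by linarith) ?_),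
      fun hc => hlim _ (hdom.tendsto_sum_rpow_atTop (by linarith) ?_)⟩ <;> rw [hsum01]
    · exact neg_lt_zero.2 (mul_pos hK hc)
    · exact neg_pos.2 (mul_neg_of_pos_of_neg hK hc)
  · rintro ⟨h0, h1, h2⟩
    rw [← hsum11 h1]
    exact hlim _ ((hdom11 h0 h1 h2).tendsto_sum_rpow_nhds rfl)
  · rintro ⟨h0, h1, h2⟩
    have hval : -(c 0 * c 2) - (c 1) ^ 2 = ∑ p ∈ {(0, 2), (2, 0), (1, 1)}, A p := by
      rw [Finset.sum_insert (by simp), Finset.sum_insert (by simp), hsum11 h1]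
      simp only [hA, decCoeff, h0, h2]
      ring
    rw [hval]
    exact hlim _ ((hdom022 h0 h1 h2).tendsto_sum_rpow_nhds rfl)
  · rintro ⟨h0, h1, h2, h2'⟩
    have hK : 0 < η 2 * (η 2 - 1) * c 0 / 2 := half_pos (mul_pos (by nlinarith) hc0)
    have hdom := hdom02 h0 h1 h2'
    refine ⟨fun hc => hlim _ (hdom.tendsto_sum_rpow_atBot (by linarith) ?_),
      fun hc => hlim _ (hdom.tendsto_sum_rpow_atTop (by linarith) ?_)⟩ <;> rw [hsum02 h0]
    · exact neg_lt_zero.2 (mul_pos hK hc)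
    · exact neg_pos.2 (mul_neg_of_pos_of_neg hK hc)
  · rintro ⟨h0, h1, h1'⟩
    have hK : (η 1 * (η 1 - 1) + η 0 * (η 0 - 1) + 4 * η 0 * η 1) * c 0 / 2 < 0 :=
      div_neg_of_neg_of_pos (mul_neg_of_neg_of_pos (by nlinarith) hc0) two_pos
    have hdom := hdom01 (hzero00 (Or.inl h0))
    refine ⟨fun hc => hlim _ (hdom.tendsto_sum_rpow_atTop (by linarith) ?_),
      fun hc => hlim _ (hdom.tendsto_sum_rpow_atBot (by linarith) ?_)⟩ <;> rw [hsum01]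
    · exact neg_pos.2 (mul_neg_of_neg_of_pos hK hc)
    · exact neg_lt_zero.2 (mul_pos_of_neg_of_neg hK hc)
  · intro h0
    have hK : 0 < η 0 * (3 * η 0 - 1) := by nlinarith
    refine hlim _ (hdom00.tendsto_sum_rpow_atBot (by linarith) ?_)
    rw [hsum00]
    exact neg_lt_zero.2 (by positivity)
end
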